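/- arXiv:math/0208178 — 2 statements merged into one kernel-verified Lean document; each statement's English description precedes it below -/
import Mathlib

section
/- Lemma (reduction to a globally generated polygon). Let a ∈ ℤⁿ with a_i ≥ 0 for all i, and let S = P(a) ∩ ℤ² (note 0 ∈ S, so S is nonempty). Then there exist integers b_1, …, b_n with 0 ≤ b_i ≤ a_i for every i such that: P(b) equals the convex hull of S, P(b) is globally generated (in particular every extreme point of P(b) lies in ℤ²), and P(b) ∩ ℤ² = P(a) ∩ ℤ². (This is the combinatorial form of: for an effective divisor D = Σ a_i D_i on a smooth projective toric surface there exist 0 ≤ b_i ≤ a_i such that D′ = Σ b_i D_i has O(D′) globally generated and H⁰(X, O(D′)) → H⁰(X, O(D)) an isomorphism.) -/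
open scoped Pointwise

/-- The real vector in `ℝ²` corresponding to an integer vector. -/
def vecR (m : ℤ × ℤ) : ℝ × ℝ := ((m.1 : ℝ), (m.2 : ℝ))

/-- The standard inner (dot) product on `ℝ²`. -/
def dotR (u w : ℝ × ℝ) : ℝ := u.1 * w.1 + u.2 * w.2

/-- The standard lattice `ℤ²` viewed inside `ℝ²`. -/
def latticeR2 : Set (ℝ × ℝ) := {u | ∃ m : ℤ × ℤ, u = vecR m}

/-- The data of a complete smooth fan in `ℝ²`: `n` primitive integer vectors
`v 0, …, v (n-1)` (indices modulo `n`) such that `det (v i, v (i+1)) = 1` for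
every `i`, and such that the rays through the `v i`, taken in this cyclic
order, wind exactly once counterclockwise around the origin.  The last
condition is expressed by saying that every nonzero vector of `ℝ²` lies in
exactly one of the half-open cones `{s • v i + t • v (i+1) : s ≥ 0, t > 0}`. -/
def IsCompleteSmoothFan (n : ℕ) (v : ZMod n → ℤ × ℤ) : Prop :=
  (∀ i, IsCoprime (v i).1 (v i).2) ∧
  (∀ i, (v i).1 * (v (i + 1)).2 - (v i).2 * (v (i + 1)).1 = 1) ∧
  (∀ u : ℝ × ℝ, u ≠ 0 →
    ∃! i : ZMod n, ∃ s t : ℝ, 0 ≤ s ∧ 0 < t ∧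
      u = s • vecR (v i) + t • vecR (v (i + 1)))

/-- `Pgon n v a = P(a) = {u ∈ ℝ² : ⟨u, v i⟩ ≥ -a i for all i}`. -/
def Pgon (n : ℕ) (v : ZMod n → ℤ × ℤ) (a : ZMod n → ℤ) : Set (ℝ × ℝ) :=
  {u | ∀ i, -(a i : ℝ) ≤ dotR u (vecR (v i))}

/-- `face n v a i = σ_i(a) = P(a) ∩ {u : ⟨u, v i⟩ = -a i}`. -/
def face (n : ℕ) (v : ZMod n → ℤ × ℤ) (a : ZMod n → ℤ) (i : ZMod n) :
    Set (ℝ × ℝ) :=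
  {u ∈ Pgon n v a | dotR u (vecR (v i)) = -(a i : ℝ)}

/-- `P(a)` is ample: each face `σ_i(a)` is one-dimensional, i.e. a
nondegenerate segment (it contains two distinct points). -/
def IsAmplePgon (n : ℕ) (v : ZMod n → ℤ × ℤ) (a : ZMod n → ℤ) : Prop :=
  ∀ i, ∃ x ∈ face n v a i, ∃ y ∈ face n v a i, x ≠ y

/-- `P(a)` is globally generated: `P(a)` is nonempty, the minimum of
`⟨·, v i⟩` over `P(a)` equals `-a i` for every `i` (equivalently each face
`σ_i(a)` is nonempty), and every extreme point of `P(a)` is a lattice point. -/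
def IsGGPgon (n : ℕ) (v : ZMod n → ℤ × ℤ) (a : ZMod n → ℤ) : Prop :=
  (Pgon n v a).Nonempty ∧
  (∀ i, (face n v a i).Nonempty) ∧
  ∀ u ∈ Set.extremePoints ℝ (Pgon n v a), u ∈ latticeR2

def dZ (m w : ℤ × ℤ) : ℤ := m.1 * w.1 + m.2 * w.2

theorem dotR_vecR (m w : ℤ × ℤ) : dotR (vecR m) (vecR w) = (dZ m w : ℝ) := by
  simp [dotR, vecR, dZ]

theorem vecR_mem_Pgon (n : ℕ) (v : ZMod n → ℤ × ℤ) (a : ZMod n → ℤ) (m : ℤ × ℤ) :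
    vecR m ∈ Pgon n v a ↔ ∀ i, -(a i) ≤ dZ m (v i) := by
  simp only [Pgon, Set.mem_setOf_eq, dotR_vecR]
  exact forall_congr' fun i => by exact_mod_cast Iff.rfl

theorem exists_min (n : ℕ) (v : ZMod n → ℤ × ℤ) (a : ZMod n → ℤ) (ha : ∀ i, 0 ≤ a i)
    (i : ZMod n) : ∃ p : ℤ × ℤ, (∀ j, -(a j) ≤ dZ p (v j)) ∧
      ∀ q : ℤ × ℤ, (∀ j, -(a j) ≤ dZ q (v j)) → dZ p (v i) ≤ dZ q (v i) := by
  obtain ⟨lb, ⟨p, hp, rfl⟩, hl⟩ := Int.exists_least_of_bdd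
    (P := fun z => ∃ p : ℤ × ℤ, (∀ j, -(a j) ≤ dZ p (v j)) ∧ dZ p (v i) = z)
    ⟨-(a i), by rintro z ⟨p, hp, rfl⟩; exact hp i⟩
    ⟨0, 0, fun j => by simp [dZ, ha j], by simp [dZ]⟩
  exact ⟨p, hp, fun q hq => hl _ ⟨q, hq, rfl⟩⟩

theorem not_interior (n : ℕ) (v : ZMod n → ℤ × ℤ)
    (hv : IsCompleteSmoothFan n v) (i j : ZMod n) (c d : ℤ) (hc : 0 < c) (hd : 0 < d)
    (h1 : (v j).1 = c * (v i).1 + d * (v (i+1)).1)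
    (h2 : (v j).2 = c * (v i).2 + d * (v (i+1)).2) : False := by
  obtain ⟨-, hdet, hu⟩ := hv
  have hne : vecR (v j) ≠ 0 := by
    intro h
    have e1 : (v j).1 = 0 := by simpa [vecR] using congrArg Prod.fst h
    have e2 : (v j).2 = 0 := by simpa [vecR] using congrArg Prod.snd h
    have := hdet j
    rw [e1, e2] at this
    simp at this
  have huni := (hu _ hne).unique
    (y₁ := i) (y₂ := j - 1)
    ⟨c, d, by exact_mod_cast hc.le, by exact_mod_cast hd, by
      simp only [vecR, h1, h2]; ext <;> simp⟩
    ⟨0, 1, le_rfl, one_pos, by simp⟩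
  have hj : j = i + 1 := by rw [huni]; ring
  subst hj
  have h3 := hdet i
  -- det of (v (i+1)) with itself is zero, yet equals c
  have : c * ((v i).1 * (v (i + 1)).2 - (v i).2 * (v (i + 1)).1) = 0 := by
    linear_combination (v (i+1)).1 * h2 - (v (i+1)).2 * h1
  rw [h3] at this
  omega

theorem exists_vertex (n : ℕ) (v : ZMod n → ℤ × ℤ)
    (hv : IsCompleteSmoothFan n v) (a : ZMod n → ℤ) (p : ZMod n → ℤ × ℤ)
    (hp : ∀ i j, -(a j) ≤ dZ (p i) (v j))
    (hm : ∀ i, ∀ q : ℤ × ℤ, (∀ j, -(a j) ≤ dZ q (v j)) → dZ (p i) (v i) ≤ dZ q (v i))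
    (i : ZMod n) : ∃ r : ℤ × ℤ, (∀ j, -(a j) ≤ dZ r (v j)) ∧
      dZ r (v i) = dZ (p i) (v i) ∧ dZ r (v (i+1)) = dZ (p (i+1)) (v (i+1)) := by
  have hdet := hv.2.1 i
  set x := dZ (p i) (v i) with hx
  set y := dZ (p (i+1)) (v (i+1)) with hy
  let r : ℤ × ℤ := (x * (v (i+1)).2 - y * (v i).2, y * (v i).1 - x * (v (i+1)).1)
  have hr1 : dZ r (v i) = x := by
    simp only [dZ, r]; linear_combination x * hdet
  have hr2 : dZ r (v (i+1)) = y := by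
    simp only [dZ, r]; linear_combination y * hdet
  refine ⟨r, fun j => ?_, hr1, hr2⟩
  let c := (v j).1 * (v (i+1)).2 - (v j).2 * (v (i+1)).1
  let d := (v i).1 * (v j).2 - (v i).2 * (v j).1
  have h1 : (v j).1 = c * (v i).1 + d * (v (i+1)).1 := by
    simp only [c, d]; linear_combination (-(v j).1) * hdet
  have h2 : (v j).2 = c * (v i).2 + d * (v (i+1)).2 := by
    simp only [c, d]; linear_combination (-(v j).2) * hdet
  have key : ∀ m : ℤ × ℤ, dZ m (v j) = c * dZ m (v i) + d * dZ m (v (i+1)) := by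
    intro m
    simp only [dZ]; linear_combination m.1 * h1 + m.2 * h2
  rw [key, hr1, hr2]
  rcases le_or_gt c 0 with hc | hc
  · have e1 := hp (i+1) j
    rw [key, ← hy] at e1
    have e2 := hm i (p (i+1)) (hp (i+1))
    nlinarith
  rcases le_or_gt d 0 with hd | hd
  · have e1 := hp i j
    rw [key, ← hx] at e1
    have e2 := hm (i+1) (p i) (hp i)
    nlinarith
  exact (not_interior n v hv i j c d hc hd h1 h2).elim

theorem Pgon_convex (n : ℕ) (v : ZMod n → ℤ × ℤ) (b : ZMod n → ℤ) :
    Convex ℝ (Pgon n v b) := by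
  intro x hx y hy s t hs ht hst i
  have e1 := hx i
  have e2 := hy i
  simp only [dotR, Prod.fst_add, Prod.snd_add, Prod.smul_fst, Prod.smul_snd, smul_eq_mul] at *
  have : t = 1 - s := by linarith
  subst this
  nlinarith [mul_le_mul_of_nonneg_left e1 hs, mul_le_mul_of_nonneg_left e2 ht]

theorem Pgon_sub (n : ℕ) (hn : 3 ≤ n) (v : ZMod n → ℤ × ℤ)
    (hv : IsCompleteSmoothFan n v) (b : ZMod n → ℤ) (r : ZMod n → ℤ × ℤ)
    (h1 : ∀ i, dZ (r i) (v i) = - b i) (h2 : ∀ i, dZ (r i) (v (i+1)) = - b (i+1)) :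
    Pgon n v b ⊆ convexHull ℝ (Set.range fun i => vecR (r i)) := by
  haveI : NeZero n := ⟨by omega⟩
  intro u hu
  by_contra hcon
  have hclosed : IsClosed (convexHull ℝ (Set.range fun i => vecR (r i))) :=
    ((Set.finite_range _).isCompact_convexHull ℝ).isClosed
  obtain ⟨f, c, hf1, hf2⟩ := geometric_hahn_banach_point_closed
    (convex_convexHull ℝ _) hclosed hcon
  have hf : ∀ x : ℝ × ℝ, f x = dotR x (f (1, 0), f (0, 1)) := by
    intro x
    have : x = x.1 • ((1, 0) : ℝ × ℝ) + x.2 • ((0, 1) : ℝ × ℝ) := by ext <;> simp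
    conv_lhs => rw [this]
    rw [map_add, map_smul, map_smul]
    simp [dotR]
  generalize hw : ((f (1, 0), f (0, 1)) : ℝ × ℝ) = w at hf
  have hlt : ∀ i, dotR u w < dotR (vecR (r i)) w := by
    intro i
    rw [← hf, ← hf]
    exact hf1.trans (hf2 _ (subset_convexHull ℝ _ ⟨i, rfl⟩))
  have hw0 : w ≠ 0 := by
    rintro rfl
    have := hlt 0
    simp [dotR] at this
  obtain ⟨i, ⟨s, t, hs, ht, hst⟩, -⟩ := hv.2.2 w hw0
  have key : ∀ x, dotR x w = s * dotR x (vecR (v i)) + t * dotR x (vecR (v (i+1))) := by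
    intro x
    rw [hst]; simp [dotR]; ring
  have e := hlt i
  rw [key, key, dotR_vecR, dotR_vecR, h1, h2] at e
  have u1 := mul_le_mul_of_nonneg_left (hu i) hs
  have u2 := mul_le_mul_of_nonneg_left (hu (i+1)) ht.le
  push_cast at e
  linarith

theorem lemma_reduction (n : ℕ) (hn : 3 ≤ n) (v : ZMod n → ℤ × ℤ)
    (hv : IsCompleteSmoothFan n v) (a : ZMod n → ℤ) (ha : ∀ i, 0 ≤ a i) :
    ∃ b : ZMod n → ℤ, (∀ i, 0 ≤ b i ∧ b i ≤ a i) ∧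
      Pgon n v b = convexHull ℝ (Pgon n v a ∩ latticeR2) ∧
      IsGGPgon n v b ∧
      Pgon n v b ∩ latticeR2 = Pgon n v a ∩ latticeR2 := by
  choose p hp hm using exists_min n v a ha
  choose r hr hr1 hr2 using exists_vertex n v hv a p hp hm
  have hsub : Pgon n v (fun i => - dZ (p i) (v i)) ⊆ Pgon n v a := by
    intro u hu i
    refine le_trans ?_ (hu i)
    have := hp i i
    push_cast
    rw [neg_neg]
    exact_mod_cast this
  have hSb : Pgon n v a ∩ latticeR2 ⊆ Pgon n v (fun i => - dZ (p i) (v i)) := by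
    rintro _ ⟨hu, m, rfl⟩
    rw [vecR_mem_Pgon] at hu ⊢
    intro i
    rw [neg_neg]
    exact hm i m hu
  have hrS : ∀ i, vecR (r i) ∈ Pgon n v a ∩ latticeR2 := fun i =>
    ⟨(vecR_mem_Pgon n v a _).2 (hr i), _, rfl⟩
  have heq : Pgon n v (fun i => - dZ (p i) (v i)) = convexHull ℝ (Pgon n v a ∩ latticeR2) := by
    apply Set.Subset.antisymm
    · refine (Pgon_sub n hn v hv _ r (fun i => by rw [neg_neg, hr1])
        (fun i => by rw [neg_neg, hr2])).trans (convexHull_mono ?_)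
      rintro _ ⟨i, rfl⟩
      exact hrS i
    · exact convexHull_min hSb (Pgon_convex n v _)
  refine ⟨fun i => - dZ (p i) (v i), fun i => ⟨?_, ?_⟩, heq, ⟨?_, ?_, ?_⟩, ?_⟩
  · have := hm i 0 (fun j => by simp [dZ, ha j])
    simp only [dZ, Prod.fst_zero, Prod.snd_zero, zero_mul, add_zero] at this ⊢
    omega
  · have := hp i i
    show - dZ (p i) (v i) ≤ a i
    omega
  · exact ⟨_, hSb (hrS 0)⟩
  · intro i
    refine ⟨vecR (r i), hSb (hrS i), ?_⟩
    rw [dotR_vecR, hr1]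
    push_cast
    ring
  · intro u hu
    rw [heq] at hu
    exact (extremePoints_convexHull_subset hu).2
  · exact Set.Subset.antisymm (fun u hu => ⟨hsub hu.1, hu.2⟩) (fun u hu => ⟨hSb hu, hu.2⟩)
end

section
/- Proposition (segment case of Theorem 1). Let a, b ∈ ℤⁿ with P(a) ample, and suppose P(b) is globally generated and one-dimensional, i.e., P(b) is a line segment (not a single point) whose two endpoints lie in ℤ². Then every lattice point of the Minkowski sum P(a) + P(b) is the sum of a lattice point of P(a) and a lattice point of P(b); that is, (P(a) ∩ ℤ²) + (P(b) ∩ ℤ²) = (P(a) + P(b)) ∩ ℤ². -/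
open scoped Pointwise

lemma lin_aux {A B c s r t : ℝ} (h1 : c ≤ A + s * B) (h2 : c ≤ A + t * B) (hs : s ≤ r)
    (ht : r ≤ t) : c ≤ A + r * B := by
  rcases le_total 0 B with hB | hB
  · nlinarith [mul_le_mul_of_nonneg_right hs hB]
  · nlinarith [mul_le_mul_of_nonpos_right ht hB]

lemma mem_iff {n : ℕ} {v : ZMod n → ℤ × ℤ} {a : ZMod n → ℤ} {x y : ℝ} :
    (x, y) ∈ Pgon n v a ↔ ∀ i, -(a i : ℝ) ≤ x * ((v i).1 : ℝ) + y * ((v i).2 : ℝ) := Iff.rfl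

lemma line_mem {n : ℕ} {v : ZMod n → ℤ × ℤ} {a : ZMod n → ℤ} {x y p q s r t : ℝ}
    (h1 : (x + s * p, y + s * q) ∈ Pgon n v a) (h2 : (x + t * p, y + t * q) ∈ Pgon n v a)
    (hs : s ≤ r) (ht : r ≤ t) : (x + r * p, y + r * q) ∈ Pgon n v a := by
  rw [mem_iff] at *
  intro i
  have := lin_aux (A := x * ((v i).1 : ℝ) + y * ((v i).2 : ℝ))
    (B := p * ((v i).1 : ℝ) + q * ((v i).2 : ℝ)) (c := -(a i : ℝ)) (s := s) (t := t) (r := r)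
    (by linarith [h1 i]) (by linarith [h2 i]) hs ht
  linarith

lemma vertex_mem {n : ℕ} {v : ZMod n → ℤ × ℤ} (hv : IsCompleteSmoothFan n v) {a : ZMod n → ℤ}
    (ha : ∀ i, (face n v a i).Nonempty) (j : ZMod n) (x y : ℝ)
    (h1 : x * ((v j).1 : ℝ) + y * ((v j).2 : ℝ) = -(a j : ℝ))
    (h2 : x * ((v (j+1)).1 : ℝ) + y * ((v (j+1)).2 : ℝ) = -(a (j+1) : ℝ)) :
    (x, y) ∈ Pgon n v a := by
  obtain ⟨-, hdet, hfan⟩ := hv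
  rw [mem_iff]
  intro l
  have hd : ((v j).1 : ℝ) * ((v (j+1)).2 : ℝ) - ((v j).2 : ℝ) * ((v (j+1)).1 : ℝ) = 1 := by
    exact_mod_cast hdet j
  have hdl : ((v (l-1)).1 : ℝ) * ((v l).2 : ℝ) - ((v (l-1)).2 : ℝ) * ((v l).1 : ℝ) = 1 := by
    have := hdet (l-1)
    rw [sub_add_cancel] at this
    exact_mod_cast this
  obtain ⟨α, hα⟩ : ∃ α : ℝ, α = ((v l).1 : ℝ) * ((v (j+1)).2 : ℝ)
    - ((v l).2 : ℝ) * ((v (j+1)).1 : ℝ) := ⟨_, rfl⟩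
  obtain ⟨β, hβ⟩ : ∃ β : ℝ, β = ((v j).1 : ℝ) * ((v l).2 : ℝ)
    - ((v j).2 : ℝ) * ((v l).1 : ℝ) := ⟨_, rfl⟩
  have e1 : ((v l).1 : ℝ) = α * ((v j).1 : ℝ) + β * ((v (j+1)).1 : ℝ) := by
    rw [hα, hβ]; linear_combination (-((v l).1 : ℝ)) * hd
  have e2 : ((v l).2 : ℝ) = α * ((v j).2 : ℝ) + β * ((v (j+1)).2 : ℝ) := by
    rw [hα, hβ]; linear_combination (-((v l).2 : ℝ)) * hd
  have key : x * ((v l).1 : ℝ) + y * ((v l).2 : ℝ) = α * (-(a j : ℝ)) + β * (-(a (j+1) : ℝ)) := by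
    rw [e1, e2]; linear_combination α * h1 + β * h2
  rcases le_or_gt β 0 with hb | hb
  · obtain ⟨⟨z, w⟩, hz, hz'⟩ := ha j
    rw [mem_iff] at hz
    have hz' : z * ((v j).1 : ℝ) + w * ((v j).2 : ℝ) = -(a j : ℝ) := hz'
    have k2 := hz l
    have k3 := mul_le_mul_of_nonpos_left (hz (j+1)) hb
    have : z * ((v l).1 : ℝ) + w * ((v l).2 : ℝ) = α * (-(a j : ℝ)) +
       β * (z * ((v (j+1)).1 : ℝ) + w * ((v (j+1)).2 : ℝ)) := by
      rw [e1, e2]; linear_combination α * hz'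
    linarith
  rcases le_or_gt α 0 with hb' | hb'
  · obtain ⟨⟨z, w⟩, hz, hz'⟩ := ha (j+1)
    rw [mem_iff] at hz
    have hz' : z * ((v (j+1)).1 : ℝ) + w * ((v (j+1)).2 : ℝ) = -(a (j+1) : ℝ) := hz'
    have k2 := hz l
    have k3 := mul_le_mul_of_nonpos_left (hz j) hb'
    have : z * ((v l).1 : ℝ) + w * ((v l).2 : ℝ) = β * (-(a (j+1) : ℝ)) +
       α * (z * ((v j).1 : ℝ) + w * ((v j).2 : ℝ)) := by
      rw [e1, e2]; linear_combination β * hz'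
    linarith
  exfalso
  have hne : vecR (v l) ≠ 0 := by
    intro h
    have h1 : ((v l).1 : ℝ) = 0 := congrArg Prod.fst h
    have h2 : ((v l).2 : ℝ) = 0 := congrArg Prod.snd h
    rw [h1, h2] at hdl
    norm_num at hdl
  have hu := (hfan (vecR (v l)) hne).unique (y₁ := j) (y₂ := l - 1)
    ⟨α, β, hb'.le, hb, Prod.ext e1 e2⟩ ⟨0, 1, le_rfl, one_pos, by simp⟩
  have hl : l = j + 1 := by rw [hu]; ring
  subst hl
  have : α = 0 := by rw [hα]; ring
  linarith

lemma edge_mem {n : ℕ} {v : ZMod n → ℤ × ℤ} (hv : IsCompleteSmoothFan n v) {a : ZMod n → ℤ}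
    (ha : IsAmplePgon n v a) (j : ZMod n) : ∃ x y : ℝ,
    x * ((v j).1 : ℝ) + y * ((v j).2 : ℝ) = -(a j : ℝ) ∧
    (x, y) ∈ Pgon n v a ∧ (x + (v j).2, y - (v j).1) ∈ Pgon n v a := by
  have hf : ∀ i, (face n v a i).Nonempty := fun i => by
    obtain ⟨x, hx, -⟩ := ha i
    exact ⟨x, hx⟩
  obtain ⟨k, hk⟩ : ∃ k, k = j - 1 := ⟨_, rfl⟩
  have hkj : k + 1 = j := by rw [hk]; ring
  have hd1 := hv.2.1 j
  have hd0 := hv.2.1 k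
  rw [hkj] at hd0
  -- previous vertex
  obtain ⟨X, hX⟩ : ∃ X : ℤ, X = -(a k) * (v j).2 + (a j) * (v k).2 := ⟨_, rfl⟩
  obtain ⟨Y, hY⟩ : ∃ Y : ℤ, Y = -(v k).1 * (a j) + (v j).1 * (a k) := ⟨_, rfl⟩
  have X1 : X * (v k).1 + Y * (v k).2 = -(a k) := by
    rw [hX, hY]; linear_combination (-(a k)) * hd0
  have X2 : X * (v j).1 + Y * (v j).2 = -(a j) := by
    rw [hX, hY]; linear_combination (-(a j)) * hd0
  obtain ⟨L, hL⟩ : ∃ L : ℤ, L = X * (v (j+1)).1 + Y * (v (j+1)).2 + a (j+1) := ⟨_, rfl⟩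
  have m0 : ((X : ℝ), (Y : ℝ)) ∈ Pgon n v a := by
    apply vertex_mem hv hf k
    · exact_mod_cast X1
    · rw [hkj]; exact_mod_cast X2
  have X2' : (X : ℝ) * ((v j).1 : ℝ) + Y * ((v j).2 : ℝ) = -(a j : ℝ) := by exact_mod_cast X2
  have X1' : (X : ℝ) * ((v k).1 : ℝ) + Y * ((v k).2 : ℝ) = -(a k : ℝ) := by exact_mod_cast X1
  have hd1' : ((v j).1 : ℝ) * ((v (j+1)).2 : ℝ) - ((v j).2 : ℝ) * ((v (j+1)).1 : ℝ) = 1 := by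
    exact_mod_cast hd1
  have hd0' : ((v k).1 : ℝ) * ((v j).2 : ℝ) - ((v k).2 : ℝ) * ((v j).1 : ℝ) = 1 := by
    exact_mod_cast hd0
  have hL' : (L : ℝ) = X * (v (j+1)).1 + Y * (v (j+1)).2 + a (j+1) := by exact_mod_cast hL
  have m1 : ((X : ℝ) + L * (v j).2, (Y : ℝ) + L * (-(v j).1)) ∈ Pgon n v a := by
    apply vertex_mem hv hf j
    · linear_combination X2'
    · linear_combination (-(L : ℝ)) * hd1' - hL'
  have L0 : 0 ≤ L := by
    have := (mem_iff.1 m0) (j+1)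
    have : (0 : ℝ) ≤ L := by rw [hL']; linarith
    exact_mod_cast this
  have Lne : L ≠ 0 := by
    intro h0
    have h0' : (L : ℝ) = 0 := by exact_mod_cast h0
    have : ∀ z ∈ face n v a j, z = ((X : ℝ), (Y : ℝ)) := by
      rintro ⟨z, w⟩ ⟨hz, hz'⟩
      have hz' : z * ((v j).1 : ℝ) + w * ((v j).2 : ℝ) = -(a j : ℝ) := hz'
      have c1 := (mem_iff.1 hz) k
      have c2 := (mem_iff.1 hz) (j+1)
      obtain ⟨s, hs⟩ : ∃ s : ℝ, s = (z - X) * (v k).1 + (w - Y) * (v k).2 := ⟨_, rfl⟩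
      have z1 : z - X = s * (v j).2 := by
        rw [hs]; linear_combination (-(z - X)) * hd0' - ((v k).2 : ℝ) * (hz' - X2')
      have z2 : w - Y = - s * (v j).1 := by
        rw [hs]; linear_combination (-(w - Y)) * hd0' + ((v k).1 : ℝ) * (hz' - X2')
      have s0 : 0 ≤ s := by rw [hs]; linarith
      have s1 : s ≤ 0 := by
        have : (z - X) * (v (j+1)).1 + (w - Y) * (v (j+1)).2 = - s := by
          rw [z1, z2]; linear_combination (-s) * hd1'
        linarith
      have s2 : s = 0 := le_antisymm s1 s0
      rw [s2] at z1 z2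
      ext
      · change z = X; linarith
      · change w = Y; linarith
    obtain ⟨x, hx, y, hy, hxy⟩ := ha j
    exact hxy ((this x hx).trans (this y hy).symm)
  have L1 : (1 : ℝ) ≤ L := by
    have : 1 ≤ L := by omega
    exact_mod_cast this
  refine ⟨X, Y, X2', m0, ?_⟩
  have := line_mem (x := X) (y := Y) (p := (v j).2) (q := -(v j).1) (s := 0) (t := L) (r := 1)
    (by simpa using m0) m1 zero_le_one L1
  simpa [sub_eq_add_neg] using this

lemma normal_exists {n : ℕ} (hn : 3 ≤ n) {v : ZMod n → ℤ × ℤ} {b : ZMod n → ℤ}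
    {x1 y1 x2 y2 : ℝ} (hne : (x1, y1) ≠ (x2, y2))
    (hseg : Pgon n v b = segment ℝ (x1, y1) (x2, y2)) (c : ℝ) (hc : c ≠ 0) :
    ∃ i, (x2 - x1) * ((v i).1 : ℝ) + (y2 - y1) * ((v i).2 : ℝ) = 0 ∧
      0 < c * ((y2 - y1) * ((v i).1 : ℝ) - (x2 - x1) * ((v i).2 : ℝ)) := by
  have : NeZero n := ⟨by omega⟩
  by_contra! H
  have M1 : (x1, y1) ∈ Pgon n v b := hseg ▸ left_mem_segment ℝ _ _
  have M2 : (x2, y2) ∈ Pgon n v b := hseg ▸ right_mem_segment ℝ _ _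
  rw [mem_iff] at M1 M2
  have ev : ∀ i, ∀ᶠ ε : ℝ in nhdsWithin 0 (Set.Ioi 0), -(b i : ℝ) ≤
      ((x1 + x2) / 2 - ε * (c * (y2 - y1))) * ((v i).1 : ℝ)
      + ((y1 + y2) / 2 + ε * (c * (x2 - x1))) * ((v i).2 : ℝ) := by
    intro i
    by_cases h : (x2 - x1) * ((v i).1 : ℝ) + (y2 - y1) * ((v i).2 : ℝ) = 0
    · filter_upwards [self_mem_nhdsWithin] with ε hε
      have hε : 0 < ε := hε
      have h2 := mul_nonpos_of_nonneg_of_nonpos hε.le (H i h)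
      nlinarith [M1 i, M2 i]
    · apply Filter.Eventually.filter_mono nhdsWithin_le_nhds
      have hcont : Continuous (fun ε : ℝ => ((x1 + x2) / 2 - ε * (c * (y2 - y1))) * ((v i).1 : ℝ)
        + ((y1 + y2) / 2 + ε * (c * (x2 - x1))) * ((v i).2 : ℝ)) := by fun_prop
      have : -(b i : ℝ) < (fun ε : ℝ => ((x1 + x2) / 2 - ε * (c * (y2 - y1))) * ((v i).1 : ℝ)
        + ((y1 + y2) / 2 + ε * (c * (x2 - x1))) * ((v i).2 : ℝ)) 0 := by
        simp only [zero_mul, sub_zero, add_zero]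
        rcases lt_or_gt_of_ne h with h | h <;> linarith [M1 i, M2 i]
      filter_upwards [hcont.continuousAt.eventually (lt_mem_nhds this)] with ε hε
      exact le_of_lt hε
  obtain ⟨ε, hε, hε0⟩ := ((Filter.eventually_all.2 ev).and self_mem_nhdsWithin).exists
  have hε0 : 0 < ε := hε0
  have hm := mem_iff.2 hε
  rw [hseg] at hm
  obtain ⟨s, t, hs, ht, hst, he⟩ := hm
  have h1 : s * x1 + t * x2 = (x1 + x2) / 2 - ε * (c * (y2 - y1)) := congrArg Prod.fst he
  have h2 : s * y1 + t * y2 = (y1 + y2) / 2 + ε * (c * (x2 - x1)) := congrArg Prod.snd he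
  have hs' : s = 1 - t := by linarith
  subst hs'
  have h3 : (ε * c) * ((x2 - x1)^2 + (y2 - y1)^2) = 0 := by
    linear_combination (-(x2 - x1)) * h2 + (y2 - y1) * h1
  have h4 : (x2 - x1)^2 + (y2 - y1)^2 = 0 :=
    (mul_eq_zero.1 h3).resolve_left (mul_ne_zero hε0.ne' hc)
  apply hne
  ext
  · change x1 = x2; nlinarith [sq_nonneg (x2 - x1), sq_nonneg (y2 - y1)]
  · change y1 = y2; nlinarith [sq_nonneg (x2 - x1), sq_nonneg (y2 - y1)]

/-- every lattice slice contains a lattice point -/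
lemma slice {n : ℕ} {v : ZMod n → ℤ × ℤ} (hv : IsCompleteSmoothFan n v) {a : ZMod n → ℤ}
    (ha : IsAmplePgon n v a) (j k : ZMod n) (hk1 : (v k).1 = -(v j).1) (hk2 : (v k).2 = -(v j).2)
    (z w : ℝ) (h1 : -(a j : ℝ) ≤ z * (v j).1 + w * (v j).2)
    (h2 : z * (v j).1 + w * (v j).2 ≤ a k) :
    ∃ N : ℤ, (z + (N : ℝ) * (v j).2, w + (N : ℝ) * (-(v j).1)) ∈ Pgon n v a := by
  obtain ⟨x, y, e, p1, p2⟩ := edge_mem hv ha j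
  obtain ⟨x', y', e', p1', p2'⟩ := edge_mem hv ha k
  rw [hk1, hk2] at e' p2'
  push_cast at e' p2'
  have hd := hv.2.1 j
  have hd' : ((v j).1 : ℝ) * ((v (j+1)).2 : ℝ) - ((v j).2 : ℝ) * ((v (j+1)).1 : ℝ) = 1 := by
    exact_mod_cast hd
  -- convex parameter
  obtain ⟨τ, t0, t1, ht⟩ : ∃ τ : ℝ, 0 ≤ τ ∧ τ ≤ 1 ∧
      z * (v j).1 + w * (v j).2 = -(a j : ℝ) + τ * (a k + a j) := by
    rcases (show (0 : ℝ) ≤ a k + a j by linarith).eq_or_lt with h | h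
    · exact ⟨0, le_rfl, zero_le_one, by linarith⟩
    · refine ⟨(z * (v j).1 + w * (v j).2 + a j) / (a k + a j), ?_, ?_, ?_⟩
      · apply div_nonneg <;> linarith
      · rw [div_le_one h]; linarith
      · field_simp; ring
  -- left endpoint c of the slice, c = x + τ (x' - d - x)
  have q1 := line_mem (x := x) (y := y) (p := x' - (v j).2 - x) (q := y' + (v j).1 - y) (s := 0)
    (t := 1) (r := τ) (n := n) (v := v) (a := a) (by simpa using p1)
    (by convert p2' using 2 <;> ring) t0 t1
  have q2 := line_mem (x := x + (v j).2) (y := y - (v j).1) (p := x' - (v j).2 - x)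
    (q := y' + (v j).1 - y) (s := 0)
    (t := 1) (r := τ) (n := n) (v := v) (a := a) (by simpa using p2)
    (by convert p1' using 2 <;> ring) t0 t1
  obtain ⟨C, hC⟩ : ∃ C, C = x + τ * (x' - (v j).2 - x) := ⟨_, rfl⟩
  obtain ⟨D, hD⟩ : ∃ D, D = y + τ * (y' + (v j).1 - y) := ⟨_, rfl⟩
  have hCD : C * (v j).1 + D * (v j).2 = z * (v j).1 + w * (v j).2 := by
    rw [hC, hD, ht]; linear_combination (1 - τ) * e - τ * e'
  obtain ⟨s, hs⟩ : ∃ s : ℝ, s = -((C - z) * (v (j+1)).1 + (D - w) * (v (j+1)).2) := ⟨_, rfl⟩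
  have c1 : C = z + s * (v j).2 := by
    rw [hs]; linear_combination (-(C - z)) * hd' + ((v (j+1)).2 : ℝ) * hCD
  have c2 : D = w + s * (-(v j).1) := by
    rw [hs]; linear_combination (-(D - w)) * hd' - ((v (j+1)).1 : ℝ) * hCD
  rw [← hC, ← hD, c1, c2] at q1
  have q2' : (z + (s + 1) * (v j).2, w + (s + 1) * (-(v j).1)) ∈ Pgon n v a := by
    convert q2 using 2
    · linear_combination hC - c1
    · linear_combination hD - c2
  exact ⟨⌈s⌉, line_mem q1 q2' (Int.le_ceil s) (Int.ceil_lt_add_one s).le⟩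

lemma main_aux {n : ℕ} {v : ZMod n → ℤ × ℤ} (hv : IsCompleteSmoothFan n v) {a b : ZMod n → ℤ}
    (ha : IsAmplePgon n v a) (j k : ZMod n) (hk1 : (v k).1 = -(v j).1) (hk2 : (v k).2 = -(v j).2)
    (M1 M2 : ℤ × ℤ) (K : ℤ) (hK : 0 ≤ K) (e1 : M2.1 - M1.1 = K * (v j).2)
    (e2 : M2.2 - M1.2 = K * (-(v j).1)) (hseg : Pgon n v b = segment ℝ (vecR M1) (vecR M2)) :
    (Pgon n v a + Pgon n v b) ∩ latticeR2 ⊆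
    (Pgon n v a ∩ latticeR2) + (Pgon n v b ∩ latticeR2) := by
  rintro p ⟨⟨⟨x, y⟩, hx, ⟨x', y'⟩, hy, hp⟩, ⟨P, hP⟩⟩
  have hp : ((x, y) : ℝ × ℝ) + (x', y') = p := hp
  rw [hP] at hp
  have hp1 : x + x' = P.1 := congrArg Prod.fst hp
  have hp2 : y + y' = P.2 := congrArg Prod.snd hp
  have hB1 : vecR M1 ∈ Pgon n v b := hseg ▸ left_mem_segment ℝ _ _
  have hB2 : vecR M2 ∈ Pgon n v b := hseg ▸ right_mem_segment ℝ _ _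
  have e1' : (M2.1 : ℝ) - M1.1 = K * (v j).2 := by exact_mod_cast e1
  have e2' : (M2.2 : ℝ) - M1.2 = K * (-(v j).1) := by exact_mod_cast e2
  rw [hseg] at hy
  obtain ⟨s, t, hs, ht, hst, he⟩ := hy
  have h1 : s * M1.1 + t * M2.1 = x' := congrArg Prod.fst he
  have h2 : s * M1.2 + t * M2.2 = y' := congrArg Prod.snd he
  have hs' : s = 1 - t := by linarith
  subst hs'
  have hx1 : x = ((P.1 : ℝ) - M1.1) + (-(t * K)) * (v j).2 := by
    linear_combination hp1 + h1 - t * e1'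
  have hy1 : y = ((P.2 : ℝ) - M1.2) + (-(t * K)) * (-(v j).1) := by
    linear_combination hp2 + h2 - t * e2'
  rw [hx1, hy1] at hx
  have hK' : (0 : ℝ) ≤ K := by exact_mod_cast hK
  have htK0 : 0 ≤ t * K := mul_nonneg ht hK'
  have htK1 : t * K ≤ K := by nlinarith
  obtain ⟨N, hN⟩ := slice hv ha j k hk1 hk2 ((P.1 : ℝ) - M1.1) ((P.2 : ℝ) - M1.2)
    (by have := mem_iff.1 hx j; linarith)
    (by
      have := mem_iff.1 hx k
      rw [hk1, hk2] at this
      push_cast at this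
      linarith)
  obtain ⟨T, T0, T1, hT⟩ : ∃ T : ℤ, 0 ≤ T ∧ T ≤ K ∧ (((P.1 : ℝ) - M1.1) + (-(T : ℝ)) * (v j).2,
      ((P.2 : ℝ) - M1.2) + (-(T : ℝ)) * (-(v j).1)) ∈ Pgon n v a := by
    rcases lt_or_ge 0 N with h | h
    · refine ⟨0, le_rfl, hK, ?_⟩
      have h' : (0 : ℝ) < N := by exact_mod_cast h
      apply line_mem hx hN
      · push_cast; linarith
      · push_cast; linarith
    rcases lt_or_ge N (-K) with h' | h'
    · refine ⟨K, hK, le_rfl, ?_⟩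
      have h' : (N : ℝ) < -K := by exact_mod_cast h'
      apply line_mem hN hx
      · linarith
      · linarith
    · refine ⟨-N, by omega, by omega, ?_⟩
      push_cast
      rw [neg_neg]
      exact hN
  have hT0 : (0 : ℝ) ≤ T := by exact_mod_cast T0
  have hT1 : (T : ℝ) ≤ K := by exact_mod_cast T1
  have hb : ((M1.1 : ℝ) + T * (v j).2, (M1.2 : ℝ) + T * (-(v j).1)) ∈ Pgon n v b := by
    apply line_mem (s := 0) (t := K) _ _ hT0 hT1
    · simpa [vecR] using hB1
    · convert hB2 using 1
      ext
      · simp only [vecR]; linarith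
      · simp only [vecR]; linarith
  refine ⟨_, ⟨hT, (P.1 - M1.1 + (-T) * (v j).2, P.2 - M1.2 + (-T) * (-(v j).1)), ?_⟩, _,
    ⟨hb, (M1.1 + T * (v j).2, M1.2 + T * (-(v j).1)), ?_⟩, ?_⟩
  · simp [vecR]
  · simp [vecR]
  · rw [hP]
    ext
    · simp [vecR]; ring
    · simp [vecR]; ring

/-- **Proposition (segment case of Theorem 1).** If `P(a)` is ample and
`P(b)` is globally generated and is a nondegenerate segment with lattice
endpoints, then every lattice point of `P(a) + P(b)` is the sum of a lattice
point of `P(a)` and a lattice point of `P(b)`. -/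
theorem prop_segment_case (n : ℕ) (hn : 3 ≤ n) (v : ZMod n → ℤ × ℤ)
    (hv : IsCompleteSmoothFan n v) (a b : ZMod n → ℤ)
    (ha : IsAmplePgon n v a) (hb : IsGGPgon n v b)
    (hseg : ∃ m₁ m₂ : ℝ × ℝ, m₁ ∈ latticeR2 ∧ m₂ ∈ latticeR2 ∧ m₁ ≠ m₂ ∧
      Pgon n v b = segment ℝ m₁ m₂) :
    (Pgon n v a ∩ latticeR2) + (Pgon n v b ∩ latticeR2) =
      (Pgon n v a + Pgon n v b) ∩ latticeR2 := by
  apply Set.Subset.antisymm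
  · rintro p ⟨x, ⟨hx, ⟨X, hX⟩⟩, y, ⟨hy, ⟨Y, hY⟩⟩, rfl⟩
    refine ⟨⟨x, hx, y, hy, rfl⟩, (X.1 + Y.1, X.2 + Y.2), ?_⟩
    rw [hX, hY]
    simp [vecR]
  obtain ⟨_, _, ⟨M1, rfl⟩, ⟨M2, rfl⟩, hne, hs⟩ := hseg
  obtain ⟨j, j1, j2⟩ := normal_exists hn hne hs 1 one_ne_zero
  obtain ⟨k, k1, k2⟩ := normal_exists hn hne hs (-1) (by norm_num)
  have j1' : (M2.1 - M1.1) * (v j).1 + (M2.2 - M1.2) * (v j).2 = 0 := by exact_mod_cast j1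
  have k1' : (M2.1 - M1.1) * (v k).1 + (M2.2 - M1.2) * (v k).2 = 0 := by exact_mod_cast k1
  have j2' : 0 < (M2.2 - M1.2) * (v j).1 - (M2.1 - M1.1) * (v j).2 := by
    rw [one_mul] at j2; exact_mod_cast j2
  have k2' : (M2.2 - M1.2) * (v k).1 - (M2.1 - M1.1) * (v k).2 < 0 := by
    have : ((M2.2 : ℝ) - M1.2) * (v k).1 - (M2.1 - M1.1) * (v k).2 < 0 := by linarith
    exact_mod_cast this
  have hdj := hv.2.1 j
  have hdk := hv.2.1 k
  obtain ⟨K, hK⟩ : ∃ K : ℤ, K = -((M2.1 - M1.1) * (v (j+1)).1 + (M2.2 - M1.2) * (v (j+1)).2) :=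
    ⟨_, rfl⟩
  have e1 : M2.1 - M1.1 = K * (v j).2 := by
    rw [hK]; linear_combination (-(M2.1 - M1.1)) * hdj + (v (j+1)).2 * j1'
  have e2 : M2.2 - M1.2 = K * (-(v j).1) := by
    rw [hK]; linear_combination (-(M2.2 - M1.2)) * hdj - (v (j+1)).1 * j1'
  rw [e1, e2] at j2' k2' k1'
  have hK0 : K < 0 := by nlinarith [sq_nonneg (v j).1, sq_nonneg (v j).2]
  have hpar : (v j).2 * (v k).1 - (v j).1 * (v k).2 = 0 := by
    have : K * ((v j).2 * (v k).1 - (v j).1 * (v k).2) = 0 := by linear_combination k1'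
    exact (mul_eq_zero.1 this).resolve_left hK0.ne
  obtain ⟨α, hα⟩ : ∃ α, α = (v k).1 * (v (j+1)).2 - (v k).2 * (v (j+1)).1 := ⟨_, rfl⟩
  obtain ⟨β, hβ⟩ : ∃ β, β = (v j).1 * (v (k+1)).2 - (v j).2 * (v (k+1)).1 := ⟨_, rfl⟩
  have a1 : (v k).1 = α * (v j).1 := by
    rw [hα]; linear_combination (-(v k).1) * hdj - (v (j+1)).1 * hpar
  have a2 : (v k).2 = α * (v j).2 := by
    rw [hα]; linear_combination (-(v k).2) * hdj - (v (j+1)).2 * hpar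
  have hαβ : α * β = 1 := by
    rw [hβ]; rw [a1, a2] at hdk; linear_combination hdk
  have hαm : α = -1 := by
    rcases Int.eq_one_or_neg_one_of_mul_eq_one hαβ with h | h
    · exfalso
      rw [a1, a2, h] at k2'
      linarith
    · exact h
  rw [hαm] at a1 a2
  rw [segment_symm] at hs
  exact main_aux hv ha j k (by rw [a1]; ring) (by rw [a2]; ring) M2 M1 (-K) (by omega)
    (by linarith) (by linarith) hs
end
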